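/- Fix r ≥ 3, σ ∈ {-1,1}^r with σ₁ = -σ₂, and j₃,…,j_r ∈ ℤ^d; set j_{≥3} := σ₃j₃ + ⋯ + σ_rj_r, and for j₁ ∈ ℤ^d set j₂ := j₁ + σ₁ j_{≥3}. Let 0 < γ < min{(2r)^{-2}, (36d)^{-1}} and suppose j₁ ∈ R_γ, where R_γ := { j₁ ∈ ℤ^d ∖ ∪_{i∈I} C_i : (σ,j) non-resonant and |j₁| ≥ γ^{-1/2}(⟨j₃⟩⋯⟨j_r⟩)^{2dr²} }, with I := { i : j_{≥3,i} ≠ 0 } and C_i := { j₁ : |j_{1,i}| ≥ 2(1 + Σ_{k=3}^r |j_{k,i}|²) }. Then there exists κ ∈ ℤ^d such that |j₁|_a² − |j₂|_a² = κ·a for all a ∈ ℝ^d, |κ|_∞ ≤ 7(⟨j₃⟩⋯⟨j_r⟩)³, and κ_{i⋆} = 0 for some i⋆ ∈ {1,…,d}. -/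

import Mathlib

open MeasureTheory
open scoped BigOperators

noncomputable section

namespace BeamPaper

abbrev Idx (d : ℕ) := Fin d → ℤ
def jnormSq (d : ℕ) (j : Idx d) : ℝ := ∑ i, ((j i : ℝ)) ^ 2
def enorm (d : ℕ) (j : Idx d) : ℝ := Real.sqrt (jnormSq d j)
def jap (d : ℕ) (j : Idx d) : ℝ := Real.sqrt (1 + jnormSq d j)
def anormSq (d : ℕ) (a : Fin d → ℝ) (j : Idx d) : ℝ := ∑ i, a i * (j i : ℝ) ^ 2
def omg (d : ℕ) (a : Fin d → ℝ) (j : Idx d) : ℝ := Real.sqrt (1 + anormSq d a j ^ 2)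
def prodTail (d : ℕ) {r : ℕ} (j : Fin r → Idx d) : ℝ :=
  ∏ i : Fin r, if 2 ≤ (i : ℕ) then jap d (j i) else 1
def box (d : ℕ) : Set (Fin d → ℝ) := Set.univ.pi fun _ => Set.Ioo (1 : ℝ) 4

def IsResonant {d r : ℕ} (σ : Fin r → ℤ) (j : Fin r → Idx d) : Prop :=
  Even r ∧ ∃ ρ : Equiv.Perm (Fin r),
    (∀ i, ρ (ρ i) = i) ∧ (∀ i, ρ i ≠ i) ∧
      ∀ i, (∀ l, |j (ρ i) l| = |j i l|) ∧ σ (ρ i) = - σ i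

/-- The non-resonance property of the parameter `a` established in Proposition 2.2
(`mainNR`) of the paper: lower bounds on the small divisors `Σ σ_k ω_{j_k}`,
outside resonant couples. -/
def GoodParam (d : ℕ) (a : Fin d → ℝ) : Prop :=
  ∃ γ : ℝ, 0 < γ ∧ ∃ c : ℕ → ℝ, ∃ C : ℕ → ℝ → ℝ,
    (∀ r, 0 < c r) ∧ (∀ r δ, 0 < C r δ) ∧
      ∀ (r : ℕ) (_hr : 3 ≤ r) (δ : ℝ), 0 < δ →
        ∀ (σ : Fin r → ℤ) (j : Fin r → Idx d),
          (∀ i, σ i = 1 ∨ σ i = -1) →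
          (∑ i, σ i • j i) = 0 →
          (∀ i i' : Fin r, i ≤ i' → enorm d (j i') ≤ enorm d (j i)) →
          ¬ IsResonant σ j →
          (σ ⟨0, by omega⟩ * σ ⟨1, by omega⟩ = 1 →
            c r * (γ * prodTail d j ^ (-(9 * (d : ℝ) * (r : ℝ) ^ 2))) ≤
              |∑ k, (σ k : ℝ) * omg d a (j k)|) ∧
          (σ ⟨0, by omega⟩ * σ ⟨1, by omega⟩ = -1 →
            C r δ * (γ * jap d (j ⟨0, by omega⟩) ^ (-((d : ℝ) - 1 + δ)) *
              prodTail d j ^ (-(44 * (d : ℝ) * (r : ℝ) ^ 4))) ≤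
              |∑ k, (σ k : ℝ) * omg d a (j k)|)

/-- `j_{≥3} = σ₃ j₃ + ⋯ + σ_r j_r` (0-based: indices `k ≥ 2`). -/
def jge3 (d r : ℕ) (σ : Fin r → ℤ) (jt : Fin r → Idx d) : Idx d :=
  fun l => ∑ k : Fin r, if 2 ≤ (k : ℕ) then σ k * jt k l else 0

/-- `j₂ := j₁ + σ₁ j_{≥3}`. -/
def j2of (d r : ℕ) (hr : 3 ≤ r) (σ : Fin r → ℤ) (jt : Fin r → Idx d) (j1 : Idx d) : Idx d :=
  fun l => j1 l + σ ⟨0, by omega⟩ * jge3 d r σ jt l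

/-- The family `(j₁, j₂, j₃, …, j_r)`. -/
def Jfam (d r : ℕ) (hr : 3 ≤ r) (σ : Fin r → ℤ) (jt : Fin r → Idx d) (j1 : Idx d) :
    Fin r → Idx d :=
  fun k => if (k : ℕ) = 0 then j1 else if (k : ℕ) = 1 then j2of d r hr σ jt j1 else jt k

/-- `g_{j₁}(a) = Σ_k σ_k √(1+|j_k|_a⁴)`. -/
def gfun (d r : ℕ) (hr : 3 ≤ r) (σ : Fin r → ℤ) (jt : Fin r → Idx d) (j1 : Idx d)
    (a : Fin d → ℝ) : ℝ :=
  ∑ k, (σ k : ℝ) * omg d a (Jfam d r hr σ jt j1 k)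

/-- `⟨j₃⟩⋯⟨j_r⟩` in terms of the tail data. -/
def tailProd (d r : ℕ) (jt : Fin r → Idx d) : ℝ :=
  ∏ k : Fin r, if 2 ≤ (k : ℕ) then jap d (jt k) else 1

/-- `j₁ ∈ S`: `j₁ ∉ ⋃_{i ∈ I} C_i` and `(σ,j)` is non-resonant. -/
def memS (d r : ℕ) (hr : 3 ≤ r) (σ : Fin r → ℤ) (jt : Fin r → Idx d) (j1 : Idx d) : Prop :=
  (∀ i : Fin d, jge3 d r σ jt i ≠ 0 →
      ¬ (2 * (1 + ∑ k : Fin r, if 2 ≤ (k : ℕ) then (jt k i) ^ 2 else 0) ≤ |j1 i|)) ∧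
  ¬ IsResonant σ (Jfam d r hr σ jt j1)

/-- `j₁ ∈ R_γ`: `j₁ ∈ S` and `|j₁| ≥ γ^{-1/2} (⟨j₃⟩⋯⟨j_r⟩)^{2dr²}`. -/
def memR (d r : ℕ) (hr : 3 ≤ r) (σ : Fin r → ℤ) (jt : Fin r → Idx d) (γ : ℝ)
    (j1 : Idx d) : Prop :=
  memS d r hr σ jt j1 ∧
    γ ^ (-(1 : ℝ) / 2) * tailProd d r jt ^ (2 * d * r ^ 2 : ℕ) ≤ enorm d j1

/-- For nonnegative integers, the sum is at most `3/√8` times the product of the `√(1+y²)`;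
the side conditions on small sums carry the induction. -/
theorem eight_mul_sq_sum_le {ι : Type*} (s : Finset ι) (y : ι → ℤ) (hy : ∀ k, 0 ≤ y k) :
    0 ≤ ∑ k ∈ s, y k ∧ 1 ≤ ∏ k ∈ s, (1 + y k ^ 2) ∧
    (1 ≤ ∑ k ∈ s, y k → 2 ≤ ∏ k ∈ s, (1 + y k ^ 2)) ∧
    (2 ≤ ∑ k ∈ s, y k → 4 ≤ ∏ k ∈ s, (1 + y k ^ 2)) ∧
    8 * (∑ k ∈ s, y k) ^ 2 ≤ 9 * ∏ k ∈ s, (1 + y k ^ 2) := by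
  classical
  induction s using Finset.induction_on with
  | empty => simp
  | insert a s ha ih =>
    rw [Finset.sum_insert ha, Finset.prod_insert ha]
    generalize ∑ k ∈ s, y k = S at *
    generalize ∏ k ∈ s, (1 + y k ^ 2) = T at *
    have hx := hy a
    generalize y a = x at *
    obtain ⟨h0, h1, h2, h4, h8⟩ := ih
    rcases hx.eq_or_lt with rfl | hx
    · simpa using ⟨h0, h1, h2, h4, h8⟩
    have hx1 : 1 ≤ x := hx
    have hT : 2 * T ≤ (1 + x ^ 2) * T := mul_le_mul_of_nonneg_right (by nlinarith) (by omega)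
    refine ⟨by omega, by omega, fun _ => by omega, fun h => ?_, ?_⟩
    · rcases h0.eq_or_lt with rfl | hS
      · nlinarith
      · have := h2 hS
        omega
    · rcases (by omega : S = 0 ∨ S = 1 ∨ S = 2 ∨ 3 ≤ S) with rfl | rfl | rfl | hS
      · nlinarith
      · have := h2 le_rfl
        nlinarith [sq_nonneg (x - 1)]
      · have := h4 le_rfl
        nlinarith
      · have h3 : (S + x) ^ 2 ≤ (1 + x ^ 2) * S ^ 2 := by
          have : 2 * S + 1 ≤ S ^ 2 := by nlinarith
          nlinarith [mul_le_mul_of_nonneg_left this (sq_nonneg x),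
            mul_nonneg h0 (by nlinarith : 0 ≤ x ^ 2 - x)]
        nlinarith

theorem one_add_sum_le_prod_one_add {ι : Type*} (s : Finset ι) (y : ι → ℤ)
    (hy : ∀ k, 0 ≤ y k) : 1 + ∑ k ∈ s, y k ≤ ∏ k ∈ s, (1 + y k) := by
  classical
  induction s using Finset.induction_on with
  | empty => simp
  | insert a s ha ih =>
    rw [Finset.sum_insert ha, Finset.prod_insert ha]
    have h := Finset.sum_nonneg fun k (_ : k ∈ s) => hy k
    nlinarith [hy a]

theorem jnormSq_nonneg (d : ℕ) (j : Idx d) : 0 ≤ jnormSq d j :=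
  Finset.sum_nonneg fun _ _ => sq_nonneg _

theorem one_le_tailProd (d r : ℕ) (jt : Fin r → Idx d) : 1 ≤ tailProd d r jt := by
  refine Finset.one_le_prod fun k _ => ?_
  split_ifs
  · rw [jap, Real.one_le_sqrt]
    linarith [jnormSq_nonneg d (jt k)]
  · exact le_rfl

/-- The modulus of the `i`-th coordinate of `j_k`, for `k` in the tail, and `0` otherwise. -/
def tailCoord (d r : ℕ) (jt : Fin r → Idx d) (i : Fin d) (k : Fin r) : ℤ :=
  if 2 ≤ (k : ℕ) then |jt k i| else 0

theorem tailCoord_nonneg (d r : ℕ) (jt : Fin r → Idx d) (i : Fin d) (k : Fin r) :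
    0 ≤ tailCoord d r jt i k := by
  unfold tailCoord
  split_ifs
  · exact abs_nonneg _
  · exact le_rfl

theorem prod_tailCoord_le (d r : ℕ) (jt : Fin r → Idx d) (i : Fin d) :
    ((∏ k, (1 + tailCoord d r jt i k ^ 2) : ℤ) : ℝ) ≤ tailProd d r jt ^ 2 := by
  rw [tailProd, ← Finset.prod_pow]
  push_cast
  refine Finset.prod_le_prod (fun k _ => by positivity) fun k _ => ?_
  unfold tailCoord
  split_ifs
  · have h : ((jt k i : ℤ) : ℝ) ^ 2 ≤ jnormSq d (jt k) :=
      Finset.single_le_sum (f := fun i => ((jt k i : ℤ) : ℝ) ^ 2)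
        (fun i _ => sq_nonneg _) (Finset.mem_univ i)
    rw [jap, Real.sq_sqrt (by linarith [jnormSq_nonneg d (jt k)])]
    simpa using h
  · simp

theorem abs_jge3_le (d r : ℕ) (σ : Fin r → ℤ) (hσ : ∀ i, σ i = 1 ∨ σ i = -1)
    (jt : Fin r → Idx d) (i : Fin d) :
    |jge3 d r σ jt i| ≤ ∑ k, tailCoord d r jt i k := by
  refine (Finset.abs_sum_le_sum_abs _ _).trans (Finset.sum_le_sum fun k _ => ?_)
  unfold tailCoord
  rcases hσ k with h | h <;> split_ifs <;> simp [h]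

theorem abs_jge3_le_tailProd (d r : ℕ) (σ : Fin r → ℤ) (hσ : ∀ i, σ i = 1 ∨ σ i = -1)
    (jt : Fin r → Idx d) (i : Fin d) :
    |(jge3 d r σ jt i : ℝ)| ≤ 11 / 10 * tailProd d r jt := by
  have h := (eight_mul_sq_sum_le Finset.univ _ (tailCoord_nonneg d r jt i)).2.2.2.2
  have hJ := pow_le_pow_left₀ (abs_nonneg _) (abs_jge3_le d r σ hσ jt i) 2
  have h' : (8 * |(jge3 d r σ jt i : ℝ)| ^ 2) ≤
      9 * ((∏ k, (1 + tailCoord d r jt i k ^ 2) : ℤ) : ℝ) := by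
    exact_mod_cast (by linarith : 8 * |jge3 d r σ jt i| ^ 2 ≤ _)
  have hP := prod_tailCoord_le d r jt i
  have h1 := one_le_tailProd d r jt
  refine abs_le_of_sq_le_sq' ?_ (by linarith) |>.2
  nlinarith

theorem abs_le_of_memS (d r : ℕ) (hr : 3 ≤ r) (σ : Fin r → ℤ) (jt : Fin r → Idx d)
    (j1 : Idx d) (h : memS d r hr σ jt j1) (i : Fin d) (hi : jge3 d r σ jt i ≠ 0) :
    |(j1 i : ℝ)| ≤ 2 * tailProd d r jt ^ 2 := by
  have h1 := not_le.1 (h.1 i hi)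
  have h2 := one_add_sum_le_prod_one_add Finset.univ (fun k => tailCoord d r jt i k ^ 2)
    fun k => sq_nonneg _
  have h3 : (∑ k : Fin r, if 2 ≤ (k : ℕ) then (jt k i) ^ 2 else 0) =
      ∑ k, tailCoord d r jt i k ^ 2 := by
    refine Finset.sum_congr rfl fun k _ => ?_
    unfold tailCoord
    split_ifs <;> simp
  rw [h3] at h1
  have h4 : |(j1 i : ℝ)| ≤ 2 * ((∏ k, (1 + tailCoord d r jt i k ^ 2) : ℤ) : ℝ) := by
    exact_mod_cast (by linarith : |j1 i| ≤ 2 * ∏ k, (1 + tailCoord d r jt i k ^ 2))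
  linarith [prod_tailCoord_le d r jt i]

/-- A point far from the origin in the sense of `memR` has `j_{≥3,i} = 0` for some `i`. -/
theorem exists_jge3_eq_zero (d r : ℕ) (hr : 3 ≤ r) (σ : Fin r → ℤ) (jt : Fin r → Idx d)
    (γ : ℝ) (hγ0 : 0 < γ) (hγ : γ < (36 * (d : ℝ))⁻¹)
    (j1 : Idx d) (hj1 : memR d r hr σ jt γ j1) : ∃ i, jge3 d r σ jt i = 0 := by
  by_contra! hne
  obtain ⟨hS, hR⟩ := hj1
  have h1 := one_le_tailProd d r jt
  have hb := fun i => abs_le_of_memS d r hr σ jt j1 hS i (hne i)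
  set P := tailProd d r jt
  have hd : 0 < d := by
    rcases Nat.eq_zero_or_pos d with rfl | hd
    · simp at hγ
      linarith
    · exact hd
  have hd' : (0 : ℝ) < d := by exact_mod_cast hd
  have hub : jnormSq d j1 ≤ d * (4 * P ^ 4) := by
    have : ∀ i ∈ Finset.univ, ((j1 i : ℝ)) ^ 2 ≤ 4 * P ^ 4 := fun i _ => by
      have := pow_le_pow_left₀ (abs_nonneg _) (hb i) 2
      rw [sq_abs] at this
      linarith [this]
    simpa [jnormSq] using Finset.sum_le_card_nsmul _ _ _ this
  have hg : (γ ^ (-(1 : ℝ) / 2)) ^ 2 = γ⁻¹ := by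
    rw [← Real.rpow_natCast, ← Real.rpow_mul hγ0.le, ← Real.rpow_neg_one]
    norm_num
  have hginv : 36 * (d : ℝ) < γ⁻¹ := (lt_inv_comm₀ hγ0 (by positivity)).1 hγ
  have hpow : P ^ 2 ≤ P ^ (2 * d * r ^ 2) := pow_le_pow_right₀ h1 (by
    have : 0 < d * r ^ 2 := by positivity
    rw [mul_assoc]
    omega)
  have hlow : γ⁻¹ * (P ^ 2) ^ 2 ≤ jnormSq d j1 := by
    have h0 : 0 ≤ γ ^ (-(1 : ℝ) / 2) := by positivity
    have h2 := pow_le_pow_left₀ (by positivity)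
      ((mul_le_mul_of_nonneg_left hpow h0).trans hR) 2
    rwa [mul_pow, hg, enorm, Real.sq_sqrt (jnormSq_nonneg d j1)] at h2
  have hP4 : 0 < P ^ 4 := by positivity
  nlinarith [mul_lt_mul_of_pos_right hginv hP4, mul_pos hd' hP4]

/-- Lemma 2.9, `petit_lemme`: if `0 < γ < min((2r)^{-2},(36d)^{-1})`
and `j₁ ∈ R_γ`, then there exists `κ ∈ ℤ^d` with `|j₁|_a² − |j₂|_a² = κ·a` for all
`a ∈ ℝ^d`, `|κ|_∞ ≤ 7(⟨j₃⟩⋯⟨j_r⟩)³`, and `κ_{i⋆} = 0` for some `i⋆`. -/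
theorem exists_kappa (d r : ℕ) (hr : 3 ≤ r) (σ : Fin r → ℤ)
    (hσ : ∀ i, σ i = 1 ∨ σ i = -1)
    (hσ12 : σ ⟨0, by omega⟩ = - σ ⟨1, by omega⟩)
    (jt : Fin r → Idx d) (γ : ℝ)
    (hγ0 : 0 < γ) (hγ : γ < min (((2 * (r : ℝ)) ^ 2)⁻¹) ((36 * (d : ℝ))⁻¹))
    (j1 : Idx d) (hj1 : memR d r hr σ jt γ j1) :
    ∃ κ : Idx d,
      (∀ a : Fin d → ℝ,
        anormSq d a j1 - anormSq d a (j2of d r hr σ jt j1) = ∑ i, (κ i : ℝ) * a i) ∧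
      (∀ i, ((|κ i| : ℤ) : ℝ) ≤ 7 * tailProd d r jt ^ 3) ∧
      (∃ iS, κ iS = 0) := by
  have hJ := abs_jge3_le_tailProd d r σ hσ jt
  have h1 := one_le_tailProd d r jt
  refine ⟨fun i => j1 i ^ 2 - j2of d r hr σ jt j1 i ^ 2, fun a => ?_, fun i => ?_, ?_⟩
  · simp only [anormSq]
    rw [← Finset.sum_sub_distrib]
    refine Finset.sum_congr rfl fun i _ => ?_
    push_cast
    ring
  · have hP : 0 ≤ tailProd d r jt := by linarith
    have h0 : 0 ≤ 7 * tailProd d r jt ^ 3 := by positivity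
    by_cases hi : jge3 d r σ jt i = 0
    · simpa [j2of, hi] using h0
    have hs : |((σ ⟨0, by omega⟩ : ℤ) : ℝ) * (jge3 d r σ jt i : ℝ)| ≤
        11 / 10 * tailProd d r jt := by
      rcases hσ ⟨0, by omega⟩ with h | h <;> simpa [h] using hJ i
    have hb := abs_le_of_memS d r hr σ jt j1 hj1.1 i hi
    simp only [j2of]
    push_cast
    generalize ((σ ⟨0, by omega⟩ : ℤ) : ℝ) * (jge3 d r σ jt i : ℝ) = u at *
    generalize (j1 i : ℝ) = v at *
    generalize tailProd d r jt = P at *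
    calc |v ^ 2 - (v + u) ^ 2| = |u * (2 * v + u)| := by
          rw [← abs_neg]
          ring_nf
      _ ≤ |u| * (2 * |v| + |u|) := by
          rw [abs_mul]
          gcongr
          exact (abs_add_le _ _).trans (by simp [abs_mul])
      _ ≤ 11 / 10 * P * (2 * (2 * P ^ 2) + 11 / 10 * P) := by gcongr
      _ ≤ 7 * P ^ 3 := by nlinarith [mul_le_mul_of_nonneg_left h1 (sq_nonneg P)]
  · obtain ⟨i, hi⟩ := exists_jge3_eq_zero d r hr σ jt γ hγ0
      (hγ.trans_le (min_le_right _ _)) j1 hj1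
    exact ⟨i, by simp [j2of, hi]⟩

end BeamPaper
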